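/- Let ψ : U → V be a diffeomorphism between connected open subsets U, V ⊆ ℝ² mapping every line segment contained in U into a line segment in V. Then there is a unique projective linear transformation in PGL(3,ℝ) whose restriction to U agrees with ψ. -/

import Mathlib

/-- `g ∈ GL(3,ℝ)`, viewed as a projective transformation of `ℝP²` with the embedding
`(x,y) ↦ [x : y : 1]`, is defined at every point of `U` and agrees there with `ψ`. -/
def AgreesOn (g : Matrix (Fin 3) (Fin 3) ℝ) (ψ : ℝ × ℝ → ℝ × ℝ) (U : Set (ℝ × ℝ)) : Prop :=
  ∀ p ∈ U, (g.mulVec ![p.1, p.2, 1]) 2 ≠ 0 ∧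
    ψ p = ((g.mulVec ![p.1, p.2, 1]) 0 / (g.mulVec ![p.1, p.2, 1]) 2,
           (g.mulVec ![p.1, p.2, 1]) 1 / (g.mulVec ![p.1, p.2, 1]) 2)

/-- The derivative of `F` in the direction `w`, as a function of the base point. -/
noncomputable def dirDeriv (w : ℝ × ℝ) (F : ℝ × ℝ → ℝ) : ℝ × ℝ → ℝ := fun p => fderiv ℝ F p w

section Calculus

variable {U : Set (ℝ × ℝ)} {F G : ℝ × ℝ → ℝ} {p : ℝ × ℝ}

theorem ContDiffOn.differentiableAt_of_isOpen (hF : ContDiffOn ℝ (⊤ : ℕ∞) F U) (hU : IsOpen U)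
    (hp : p ∈ U) : DifferentiableAt ℝ F p :=
  (hF.contDiffAt (hU.mem_nhds hp)).differentiableAt (by simp)

theorem ContDiffOn.dirDeriv (hF : ContDiffOn ℝ (⊤ : ℕ∞) F U) (hU : IsOpen U) (w : ℝ × ℝ) :
    ContDiffOn ℝ (⊤ : ℕ∞) (dirDeriv w F) U :=
  (hF.fderiv_of_isOpen hU (m := (⊤ : ℕ∞)) (by simp)).clm_apply contDiffOn_const

theorem dirDeriv_congr (hU : IsOpen U) (h : ∀ q ∈ U, F q = G q) (hp : p ∈ U) (w : ℝ × ℝ) :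
    dirDeriv w F p = dirDeriv w G p := by
  have : F =ᶠ[nhds p] G := Filter.eventuallyEq_of_mem (hU.mem_nhds hp) h
  simp only [dirDeriv, this.fderiv_eq]

theorem dirDeriv_add (hF : DifferentiableAt ℝ F p) (hG : DifferentiableAt ℝ G p) (w : ℝ × ℝ) :
    dirDeriv w (fun q => F q + G q) p = dirDeriv w F p + dirDeriv w G p := by
  simp [dirDeriv, fderiv_fun_add hF hG]

theorem dirDeriv_sub (hF : DifferentiableAt ℝ F p) (hG : DifferentiableAt ℝ G p) (w : ℝ × ℝ) :
    dirDeriv w (fun q => F q - G q) p = dirDeriv w F p - dirDeriv w G p := by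
  simp [dirDeriv, fderiv_fun_sub hF hG]

theorem dirDeriv_mul (hF : DifferentiableAt ℝ F p) (hG : DifferentiableAt ℝ G p) (w : ℝ × ℝ) :
    dirDeriv w (fun q => F q * G q) p = F p * dirDeriv w G p + dirDeriv w F p * G p := by
  simp [dirDeriv, fderiv_fun_mul hF hG]
  ring

theorem dirDeriv_const_mul (hF : DifferentiableAt ℝ F p) (c : ℝ) (w : ℝ × ℝ) :
    dirDeriv w (fun q => c * F q) p = c * dirDeriv w F p := by
  simp [dirDeriv, fderiv_const_mul hF]

@[simp]
theorem dirDeriv_const (c : ℝ) (w : ℝ × ℝ) : dirDeriv w (fun _ => c) = fun _ => 0 := by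
  funext p
  simp [dirDeriv]

theorem dirDeriv_eq_partials (F : ℝ × ℝ → ℝ) (w p : ℝ × ℝ) :
    dirDeriv w F p = w.1 * dirDeriv (1, 0) F p + w.2 * dirDeriv (0, 1) F p := by
  have : w = w.1 • ((1, 0) : ℝ × ℝ) + w.2 • ((0, 1) : ℝ × ℝ) := by ext <;> simp
  unfold dirDeriv
  conv_lhs => rw [this, map_add, map_smul, map_smul]
  simp

theorem dirDeriv_comm (hF : ContDiffOn ℝ (⊤ : ℕ∞) F U) (hU : IsOpen U) (hp : p ∈ U)
    (a b : ℝ × ℝ) : dirDeriv a (dirDeriv b F) p = dirDeriv b (dirDeriv a F) p := by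
  have hd : DifferentiableAt ℝ (fderiv ℝ F) p :=
    ((hF.fderiv_of_isOpen hU (m := (⊤ : ℕ∞)) (by simp)).contDiffAt
      (hU.mem_nhds hp)).differentiableAt (by simp)
  have hs : IsSymmSndFDerivAt ℝ F p :=
    (hF.contDiffAt (hU.mem_nhds hp)).isSymmSndFDerivAt (by
      rw [minSmoothness_of_isRCLikeNormedField]
      exact WithTop.coe_le_coe.mpr (le_top : (2 : ℕ∞) ≤ ⊤))
  have key : ∀ a b : ℝ × ℝ, dirDeriv a (dirDeriv b F) p = fderiv ℝ (fderiv ℝ F) p a b := by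
    intro a b
    change fderiv ℝ (fun q => fderiv ℝ F q b) p a = _
    rw [fderiv_clm_apply hd (differentiableAt_const b)]
    simp
  rw [key, key, hs.eq]

/-- A function which is constant along a line near `p` has zero derivative in its direction. -/
theorem dirDeriv_eq_zero_of_eventually_const (hF : DifferentiableAt ℝ F p) (w : ℝ × ℝ) (c : ℝ)
    (h : ∀ᶠ t : ℝ in nhds 0, F (p + t • w) = c) : dirDeriv w F p = 0 := by
  have h1 : HasDerivAt (fun t : ℝ => F (p + t • w)) (fderiv ℝ F p w) 0 :=
    hF.hasFDerivAt.hasLineDerivAt w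
  have h2 : HasDerivAt (fun t : ℝ => F (p + t • w)) 0 0 :=
    (hasDerivAt_const (0 : ℝ) c).congr_of_eventuallyEq h
  exact h1.unique h2

theorem eq_of_partials_eq_zero (hU : IsOpen U) (hUc : IsPreconnected U)
    (hF : ContDiffOn ℝ (⊤ : ℕ∞) F U) (h1 : ∀ q ∈ U, dirDeriv (1, 0) F q = 0)
    (h2 : ∀ q ∈ U, dirDeriv (0, 1) F q = 0) {q : ℝ × ℝ} (hp : p ∈ U) (hq : q ∈ U) :
    F p = F q := by
  refine hU.is_const_of_fderiv_eq_zero (𝕜 := ℝ) hUc (hF.differentiableOn (by simp)) ?_ hp hq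
  intro r hr
  ext
  · simpa [dirDeriv] using h1 r hr
  · simpa [dirDeriv] using h2 r hr

/-- A function with vanishing second partial derivatives on a connected open set is affine. -/
theorem eq_affine_of_second_partials_eq_zero (hU : IsOpen U) (hUc : IsPreconnected U)
    (hF : ContDiffOn ℝ (⊤ : ℕ∞) F U)
    (h11 : ∀ q ∈ U, dirDeriv (1, 0) (dirDeriv (1, 0) F) q = 0)
    (h21 : ∀ q ∈ U, dirDeriv (0, 1) (dirDeriv (1, 0) F) q = 0)
    (h22 : ∀ q ∈ U, dirDeriv (0, 1) (dirDeriv (0, 1) F) q = 0) (hp : p ∈ U) {q : ℝ × ℝ}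
    (hq : q ∈ U) :
    F q = dirDeriv (1, 0) F p * q.1 + dirDeriv (0, 1) F p * q.2 +
      (F p - dirDeriv (1, 0) F p * p.1 - dirDeriv (0, 1) F p * p.2) := by
  set c := dirDeriv (1, 0) F p with hc
  set d := dirDeriv (0, 1) F p with hd
  have hc' : ∀ r ∈ U, dirDeriv (1, 0) F r = c := fun r hr =>
    eq_of_partials_eq_zero hU hUc (hF.dirDeriv hU _) h11 h21 hr hp
  have hd' : ∀ r ∈ U, dirDeriv (0, 1) F r = d := fun r hr =>
    eq_of_partials_eq_zero hU hUc (hF.dirDeriv hU _)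
      (fun r hr => (dirDeriv_comm hF hU hr _ _).trans (h21 r hr)) h22 hr hp
  have hl : ∀ r w : ℝ × ℝ, dirDeriv w (fun r : ℝ × ℝ => c * r.1 + d * r.2) r
      = c * w.1 + d * w.2 := by
    intro r w
    have : HasFDerivAt (fun r : ℝ × ℝ => c * r.1 + d * r.2)
        (c • ContinuousLinearMap.fst ℝ ℝ ℝ + d • ContinuousLinearMap.snd ℝ ℝ ℝ) r :=
      (hasFDerivAt_fst.const_mul c).add (hasFDerivAt_snd.const_mul d)
    simp [dirDeriv, this.fderiv]
  have hls : ContDiff ℝ (⊤ : ℕ∞) (fun r : ℝ × ℝ => c * r.1 + d * r.2) := by fun_prop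
  have hdiff : ∀ r ∈ U, ∀ w : ℝ × ℝ,
      dirDeriv w (fun r => F r - (c * r.1 + d * r.2)) r
        = dirDeriv w F r - (c * w.1 + d * w.2) := fun r hr w => by
    rw [dirDeriv_sub (hF.differentiableAt_of_isOpen hU hr)
      (hls.differentiable (by simp) r), hl]
  have := eq_of_partials_eq_zero hU hUc (hF.sub hls.contDiffOn)
    (fun r hr => by rw [hdiff r hr, hc' r hr]; simp)
    (fun r hr => by rw [hdiff r hr, hd' r hr]; simp) hq hp
  linarith

end Calculus

section Collinear

/-- The points of a segment satisfy a common nontrivial affine equation. -/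
theorem exists_affine_equation_segment (p q : ℝ × ℝ) :
    ∃ l m c : ℝ, (l ≠ 0 ∨ m ≠ 0) ∧ ∀ z ∈ segment ℝ p q, l * z.1 + m * z.2 = c := by
  by_cases h : p = q
  · refine ⟨1, 0, p.1, by simp, fun z hz => ?_⟩
    subst h
    simp only [segment_same, Set.mem_singleton_iff] at hz
    simp [hz]
  · refine ⟨q.2 - p.2, p.1 - q.1, (q.2 - p.2) * p.1 + (p.1 - q.1) * p.2, ?_, ?_⟩
    · by_contra! hh
      exact h (Prod.ext (by linarith) (by linarith))
    · rintro z ⟨s, t, -, -, hst, rfl⟩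
      simp only [Prod.fst_add, Prod.smul_fst, smul_eq_mul, Prod.snd_add, Prod.smul_snd]
      obtain rfl : s = 1 - t := by linarith
      ring

/-- If the image of a short segment through `p` in direction `w` is collinear, then the velocity
and the acceleration of the image curve at `p` are parallel. -/
theorem acceleration_parallel_velocity {U : Set (ℝ × ℝ)} (hU : IsOpen U) {u v : ℝ × ℝ → ℝ}
    (hu : ContDiffOn ℝ (⊤ : ℕ∞) u U) (hv : ContDiffOn ℝ (⊤ : ℕ∞) v U)
    (hseg : ∀ p q : ℝ × ℝ, segment ℝ p q ⊆ U →
      ∃ p' q' : ℝ × ℝ, (fun z => (u z, v z)) '' segment ℝ p q ⊆ segment ℝ p' q')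
    {p : ℝ × ℝ} (hp : p ∈ U) (w : ℝ × ℝ) :
    dirDeriv w (dirDeriv w u) p * dirDeriv w v p
      = dirDeriv w (dirDeriv w v) p * dirDeriv w u p := by
  have hcont : Filter.Tendsto (fun t : ℝ => p + t • w) (nhds 0) (nhds p) := by
    have : Continuous (fun t : ℝ => p + t • w) := by fun_prop
    simpa using this.tendsto 0
  obtain ⟨ε, hε, hball⟩ := Metric.eventually_nhds_iff_ball.mp
    (hcont.eventually (hU.mem_nhds hp))
  have hδ : 0 < ε / 2 := by positivity
  have hline : ∀ z ∈ segment ℝ (p + (-(ε / 2)) • w) (p + (ε / 2) • w), z ∈ U := by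
    rintro z ⟨s, t, hs, ht, hst, rfl⟩
    have : s • (p + (-(ε / 2)) • w) + t • (p + (ε / 2) • w) = p + ((t - s) * (ε / 2)) • w := by
      obtain rfl : s = 1 - t := by linarith
      module
    rw [this]
    apply hball
    rw [Metric.mem_ball, Real.dist_eq, sub_zero, abs_lt]
    constructor <;> nlinarith
  obtain ⟨p', q', hpq⟩ := hseg _ _ hline
  obtain ⟨l, m, c, hlm, hlc⟩ := exists_affine_equation_segment p' q'
  have hL : ∀ t : ℝ, |t| < ε / 2 → l * u (p + t • w) + m * v (p + t • w) = c := by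
    intro t ht
    rw [abs_lt] at ht
    refine hlc _ (hpq ⟨p + t • w, ⟨1 / 2 - t / ε, 1 / 2 + t / ε, ?_, ?_, by ring, ?_⟩, rfl⟩)
    · rw [sub_nonneg, div_le_div_iff₀ hε (by norm_num)]; linarith
    · have : -(1 / 2) ≤ t / ε := by rw [le_div_iff₀ hε]; linarith
      linarith
    · have : t = t / ε * ε := by field_simp
      conv_rhs => rw [this]
      module
  have hU' : ∀ t : ℝ, |t| < ε / 2 → p + t • w ∈ U := fun t ht => by
    apply hball
    rw [Metric.mem_ball, Real.dist_eq, sub_zero]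
    linarith
  have hev : ∀ t : ℝ, |t| < ε / 2 → ∀ᶠ s : ℝ in nhds 0, |t + s| < ε / 2 := by
    intro t ht
    have : Continuous fun s : ℝ => |t + s| := by fun_prop
    have h0 := this.tendsto 0
    rw [add_zero] at h0
    exact h0.eventually (gt_mem_nhds ht)
  have h1 : ∀ t : ℝ, |t| < ε / 2 →
      l * dirDeriv w u (p + t • w) + m * dirDeriv w v (p + t • w) = 0 := by
    intro t ht
    have hdu := hu.differentiableAt_of_isOpen hU (hU' t ht)
    have hdv := hv.differentiableAt_of_isOpen hU (hU' t ht)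
    rw [← dirDeriv_const_mul hdu, ← dirDeriv_const_mul hdv,
      ← dirDeriv_add (hdu.const_mul l) (hdv.const_mul m)]
    refine dirDeriv_eq_zero_of_eventually_const ((hdu.const_mul l).add (hdv.const_mul m)) w c ?_
    filter_upwards [hev t ht] with s hs
    rw [add_assoc, ← add_smul]
    exact hL _ hs
  have hdu := (hu.dirDeriv hU w).differentiableAt_of_isOpen hU hp
  have hdv := (hv.dirDeriv hU w).differentiableAt_of_isOpen hU hp
  have h2 : l * dirDeriv w (dirDeriv w u) p + m * dirDeriv w (dirDeriv w v) p = 0 := by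
    rw [← dirDeriv_const_mul hdu, ← dirDeriv_const_mul hdv,
      ← dirDeriv_add (hdu.const_mul l) (hdv.const_mul m)]
    refine dirDeriv_eq_zero_of_eventually_const ((hdu.const_mul l).add (hdv.const_mul m)) w 0 ?_
    filter_upwards [hev 0 (by simpa using hδ)] with s hs
    exact h1 s (by simpa using hs)
  have h1' := h1 0 (by simpa using hδ)
  rw [zero_smul, add_zero] at h1'
  rcases hlm with hl | hm
  · apply mul_left_cancel₀ hl
    linear_combination dirDeriv w v p * h2 - dirDeriv w (dirDeriv w v) p * h1'
  · apply mul_left_cancel₀ hm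
    linear_combination dirDeriv w (dirDeriv w u) p * h1' - dirDeriv w u p * h2

end Collinear

section Jacobian

/-- The Jacobian determinant of `(u, v)`. -/
noncomputable def jacobian (u v : ℝ × ℝ → ℝ) : ℝ × ℝ → ℝ := fun p =>
  dirDeriv (1, 0) u p * dirDeriv (0, 1) v p - dirDeriv (0, 1) u p * dirDeriv (1, 0) v p

/-- One third of the logarithmic derivative of the Jacobian of `(u, v)` in the direction `w`. -/
noncomputable def jacobianLogDeriv (u v : ℝ × ℝ → ℝ) (w : ℝ × ℝ) : ℝ × ℝ → ℝ := fun p =>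
  dirDeriv w (jacobian u v) p * (3 * jacobian u v p)⁻¹

/-- The inverse cube root of the absolute value of the Jacobian of `(u, v)`. -/
noncomputable def jacobianWeight (u v : ℝ × ℝ → ℝ) : ℝ × ℝ → ℝ := fun p =>
  Real.exp (-(1 / 3) * Real.log (jacobian u v p))

variable {U : Set (ℝ × ℝ)} {u v : ℝ × ℝ → ℝ} {p : ℝ × ℝ}

theorem eq_zero_of_jacobian_ne_zero (hJ : jacobian u v p ≠ 0) {s t : ℝ}
    (h1 : s * dirDeriv (1, 0) u p + t * dirDeriv (0, 1) u p = 0)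
    (h2 : s * dirDeriv (1, 0) v p + t * dirDeriv (0, 1) v p = 0) : s = 0 ∧ t = 0 := by
  unfold jacobian at hJ
  constructor
  · apply mul_right_cancel₀ hJ
    linear_combination dirDeriv (0, 1) v p * h1 - dirDeriv (0, 1) u p * h2
  · apply mul_right_cancel₀ hJ
    linear_combination dirDeriv (1, 0) u p * h2 - dirDeriv (1, 0) v p * h1

theorem jacobian_ne_zero_of_injective
    (h : ∀ w : ℝ × ℝ, dirDeriv w u p = 0 → dirDeriv w v p = 0 → w = 0) :
    jacobian u v p ≠ 0 := by
  intro hJ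
  unfold jacobian at hJ
  have hv := h (dirDeriv (0, 1) v p, -dirDeriv (1, 0) v p)
    (by rw [dirDeriv_eq_partials]; simp only; linarith)
    (by rw [dirDeriv_eq_partials]; simp only; ring)
  have hu := h (dirDeriv (0, 1) u p, -dirDeriv (1, 0) u p)
    (by rw [dirDeriv_eq_partials]; simp only; ring)
    (by rw [dirDeriv_eq_partials]; simp only; linarith)
  simp only [Prod.mk_eq_zero, neg_eq_zero] at hu hv
  simpa using h (1, 0) hu.2 hv.2

theorem ContDiffOn.jacobian (hU : IsOpen U) (hu : ContDiffOn ℝ (⊤ : ℕ∞) u U)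
    (hv : ContDiffOn ℝ (⊤ : ℕ∞) v U) : ContDiffOn ℝ (⊤ : ℕ∞) (jacobian u v) U :=
  ((hu.dirDeriv hU _).mul (hv.dirDeriv hU _)).sub ((hu.dirDeriv hU _).mul (hv.dirDeriv hU _))

theorem ContDiffOn.jacobianLogDeriv (hU : IsOpen U) (hu : ContDiffOn ℝ (⊤ : ℕ∞) u U)
    (hv : ContDiffOn ℝ (⊤ : ℕ∞) v U) (hJ : ∀ q ∈ U, _root_.jacobian u v q ≠ 0) (w : ℝ × ℝ) :
    ContDiffOn ℝ (⊤ : ℕ∞) (jacobianLogDeriv u v w) U :=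
  ((ContDiffOn.jacobian hU hu hv).dirDeriv hU w).mul
    ((contDiffOn_const.mul (ContDiffOn.jacobian hU hu hv)).inv
      fun q hq => mul_ne_zero (by norm_num) (hJ q hq))

theorem ContDiffOn.jacobianWeight (hU : IsOpen U) (hu : ContDiffOn ℝ (⊤ : ℕ∞) u U)
    (hv : ContDiffOn ℝ (⊤ : ℕ∞) v U) (hJ : ∀ q ∈ U, _root_.jacobian u v q ≠ 0) :
    ContDiffOn ℝ (⊤ : ℕ∞) (jacobianWeight u v) U :=
  (contDiffOn_const.mul ((ContDiffOn.jacobian hU hu hv).log hJ)).exp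

theorem dirDeriv_jacobianWeight (hJd : DifferentiableAt ℝ (jacobian u v) p)
    (hJ : jacobian u v p ≠ 0) (w : ℝ × ℝ) :
    dirDeriv w (jacobianWeight u v) p = -(jacobianLogDeriv u v w p * jacobianWeight u v p) := by
  have := ((hJd.hasFDerivAt.log hJ).const_mul (-(1 / 3))).exp
  have h : dirDeriv w (jacobianWeight u v) p = _ := congrArg (fun L => L w) this.fderiv
  rw [h]
  simp [jacobianLogDeriv, jacobianWeight, dirDeriv]
  ring

theorem dirDeriv_jacobian (hU : IsOpen U) (hu : ContDiffOn ℝ (⊤ : ℕ∞) u U)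
    (hv : ContDiffOn ℝ (⊤ : ℕ∞) v U) (hp : p ∈ U) (w : ℝ × ℝ) :
    dirDeriv w (jacobian u v) p =
      dirDeriv (1, 0) u p * dirDeriv w (dirDeriv (0, 1) v) p
        + dirDeriv w (dirDeriv (1, 0) u) p * dirDeriv (0, 1) v p
        - (dirDeriv (0, 1) u p * dirDeriv w (dirDeriv (1, 0) v) p
        + dirDeriv w (dirDeriv (0, 1) u) p * dirDeriv (1, 0) v p) := by
  have d1 := (hu.dirDeriv hU (1, 0)).differentiableAt_of_isOpen hU hp
  have d2 := (hu.dirDeriv hU (0, 1)).differentiableAt_of_isOpen hU hp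
  have d3 := (hv.dirDeriv hU (1, 0)).differentiableAt_of_isOpen hU hp
  have d4 := (hv.dirDeriv hU (0, 1)).differentiableAt_of_isOpen hU hp
  unfold jacobian
  rw [dirDeriv_sub (d1.fun_mul d4) (d2.fun_mul d3), dirDeriv_mul d1 d4, dirDeriv_mul d2 d3]

theorem dirDeriv_dirDeriv_self (hU : IsOpen U) (hu : ContDiffOn ℝ (⊤ : ℕ∞) u U) (hp : p ∈ U)
    (w : ℝ × ℝ) :
    dirDeriv w (dirDeriv w u) p = w.1 ^ 2 * dirDeriv (1, 0) (dirDeriv (1, 0) u) p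
      + 2 * w.1 * w.2 * dirDeriv (0, 1) (dirDeriv (1, 0) u) p
      + w.2 ^ 2 * dirDeriv (0, 1) (dirDeriv (0, 1) u) p := by
  rw [dirDeriv_eq_partials _ w, dirDeriv_comm hu hU hp (1, 0) w,
    dirDeriv_comm hu hU hp (0, 1) w, dirDeriv_eq_partials _ w, dirDeriv_eq_partials _ w,
    dirDeriv_comm hu hU hp (1, 0) (0, 1)]
  ring

/-- The second derivatives of `F` satisfy the equations of a linear fractional function whose
denominator has logarithmic derivative `-a w` in the direction `w`. -/
structure IsProjectiveHessian (U : Set (ℝ × ℝ)) (a : ℝ × ℝ → ℝ × ℝ → ℝ) (F : ℝ × ℝ → ℝ) :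
    Prop where
  xx : ∀ q ∈ U, dirDeriv (1, 0) (dirDeriv (1, 0) F) q = 2 * (a (1, 0) q * dirDeriv (1, 0) F q)
  yx : ∀ q ∈ U, dirDeriv (0, 1) (dirDeriv (1, 0) F) q
    = a (0, 1) q * dirDeriv (1, 0) F q + a (1, 0) q * dirDeriv (0, 1) F q
  yy : ∀ q ∈ U, dirDeriv (0, 1) (dirDeriv (0, 1) F) q = 2 * (a (0, 1) q * dirDeriv (0, 1) F q)

theorem isProjectiveHessian_of_parallel (hU : IsOpen U) (hu : ContDiffOn ℝ (⊤ : ℕ∞) u U)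
    (hv : ContDiffOn ℝ (⊤ : ℕ∞) v U) (hJ : ∀ q ∈ U, jacobian u v q ≠ 0)
    (hpar : ∀ q ∈ U, ∀ w : ℝ × ℝ, dirDeriv w (dirDeriv w u) q * dirDeriv w v q
      = dirDeriv w (dirDeriv w v) q * dirDeriv w u q) :
    IsProjectiveHessian U (jacobianLogDeriv u v) u ∧
      IsProjectiveHessian U (jacobianLogDeriv u v) v := by
  have key : ∀ q ∈ U,
      ((dirDeriv (1, 0) (dirDeriv (1, 0) u) q
          = 2 * (jacobianLogDeriv u v (1, 0) q * dirDeriv (1, 0) u q)) ∧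
        (dirDeriv (0, 1) (dirDeriv (1, 0) u) q
          = jacobianLogDeriv u v (0, 1) q * dirDeriv (1, 0) u q
            + jacobianLogDeriv u v (1, 0) q * dirDeriv (0, 1) u q) ∧
        (dirDeriv (0, 1) (dirDeriv (0, 1) u) q
          = 2 * (jacobianLogDeriv u v (0, 1) q * dirDeriv (0, 1) u q))) ∧
      ((dirDeriv (1, 0) (dirDeriv (1, 0) v) q
          = 2 * (jacobianLogDeriv u v (1, 0) q * dirDeriv (1, 0) v q)) ∧
        (dirDeriv (0, 1) (dirDeriv (1, 0) v) q
          = jacobianLogDeriv u v (0, 1) q * dirDeriv (1, 0) v q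
            + jacobianLogDeriv u v (1, 0) q * dirDeriv (0, 1) v q) ∧
        (dirDeriv (0, 1) (dirDeriv (0, 1) v) q
          = 2 * (jacobianLogDeriv u v (0, 1) q * dirDeriv (0, 1) v q))) := by
    intro q hq
    have e1 := hpar q hq (1, 0)
    have e2 := hpar q hq (0, 1)
    have e3 := hpar q hq (1, 1)
    have e4 := hpar q hq (1, -1)
    rw [dirDeriv_dirDeriv_self hU hu hq, dirDeriv_dirDeriv_self hU hv hq,
      dirDeriv_eq_partials u, dirDeriv_eq_partials v] at e3 e4
    have hA : jacobianLogDeriv u v (1, 0) q * (3 * jacobian u v q)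
        = dirDeriv (1, 0) (jacobian u v) q :=
      inv_mul_cancel_right₀ (mul_ne_zero (by norm_num) (hJ q hq)) _
    have hB : jacobianLogDeriv u v (0, 1) q * (3 * jacobian u v q)
        = dirDeriv (0, 1) (jacobian u v) q :=
      inv_mul_cancel_right₀ (mul_ne_zero (by norm_num) (hJ q hq)) _
    rw [dirDeriv_jacobian hU hu hv hq] at hA hB
    rw [dirDeriv_comm hu hU hq (1, 0) (0, 1), dirDeriv_comm hv hU hq (1, 0) (0, 1)] at hA
    have hJq := hJ q hq
    simp only [jacobian] at hJq hA hB
    generalize jacobianLogDeriv u v (1, 0) q = A at *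
    generalize jacobianLogDeriv u v (0, 1) q = B at *
    generalize dirDeriv (1, 0) (dirDeriv (1, 0) u) q = uxx at *
    generalize dirDeriv (0, 1) (dirDeriv (1, 0) u) q = uxy at *
    generalize dirDeriv (0, 1) (dirDeriv (0, 1) u) q = uyy at *
    generalize dirDeriv (1, 0) (dirDeriv (1, 0) v) q = vxx at *
    generalize dirDeriv (0, 1) (dirDeriv (1, 0) v) q = vxy at *
    generalize dirDeriv (0, 1) (dirDeriv (0, 1) v) q = vyy at *
    generalize dirDeriv (1, 0) u q = ux at *
    generalize dirDeriv (0, 1) u q = uy at *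
    generalize dirDeriv (1, 0) v q = vx at *
    generalize dirDeriv (0, 1) v q = vy at *
    have f1 : uxx * vy - vxx * uy + 2 * (uxy * vx - vxy * ux) = 0 := by
      linear_combination (1 / 2) * e3 - (1 / 2) * e4 - e2
    have f2 : uyy * vx - vyy * ux + 2 * (uxy * vy - vxy * uy) = 0 := by
      linear_combination (1 / 2) * e3 + (1 / 2) * e4 - e1
    set J := ux * vy - uy * vx with hJdef
    have cancel : ∀ x y : ℝ, J * x = J * y → x = y := fun x y h => mul_left_cancel₀ hJq h
    have a1 : 2 * A * J = uxx * vy - vxx * uy := by linear_combination (2 / 3) * hA - (1 / 3) * f1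
    have a2 : A * J = ux * vxy - uxy * vx := by linear_combination (1 / 3) * hA + (1 / 3) * f1
    have b1 : 2 * B * J = ux * vyy - uyy * vx := by
      linear_combination (2 / 3) * hB + (1 / 3) * f2
    have b2 : B * J = uxy * vy - vxy * uy := by linear_combination (1 / 3) * hB - (1 / 3) * f2
    refine ⟨⟨cancel _ _ ?_, cancel _ _ ?_, cancel _ _ ?_⟩,
      ⟨cancel _ _ ?_, cancel _ _ ?_, cancel _ _ ?_⟩⟩
    · linear_combination uxx * hJdef - ux * a1 - uy * e1
    · linear_combination uxy * hJdef - ux * b2 - uy * a2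
    · linear_combination uyy * hJdef - uy * b1 + ux * e2
    · linear_combination vxx * hJdef - vx * a1 - vy * e1
    · linear_combination vxy * hJdef - vx * b2 - vy * a2
    · linear_combination vyy * hJdef - vy * b1 + vx * e2
  exact ⟨⟨fun q hq => (key q hq).1.1, fun q hq => (key q hq).1.2.1,
    fun q hq => (key q hq).1.2.2⟩, ⟨fun q hq => (key q hq).2.1, fun q hq => (key q hq).2.2.1,
    fun q hq => (key q hq).2.2.2⟩⟩

/-- Equality of mixed third derivatives for a solution of the projective Hessian equations. -/
theorem integrability_of_hessian (hU : IsOpen U) {A B F : ℝ × ℝ → ℝ} {e f : ℝ × ℝ}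
    (hA : ContDiffOn ℝ (⊤ : ℕ∞) A U) (hB : ContDiffOn ℝ (⊤ : ℕ∞) B U)
    (hF : ContDiffOn ℝ (⊤ : ℕ∞) F U)
    (hee : ∀ q ∈ U, dirDeriv e (dirDeriv e F) q = 2 * (A q * dirDeriv e F q))
    (hfe : ∀ q ∈ U, dirDeriv f (dirDeriv e F) q = B q * dirDeriv e F q + A q * dirDeriv f F q)
    (hp : p ∈ U) :
    (2 * dirDeriv f A p - dirDeriv e B p - A p * B p) * dirDeriv e F p
      + (A p ^ 2 - dirDeriv e A p) * dirDeriv f F p = 0 := by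
  have dA := hA.differentiableAt_of_isOpen hU hp
  have dB := hB.differentiableAt_of_isOpen hU hp
  have de := (hF.dirDeriv hU e).differentiableAt_of_isOpen hU hp
  have df := (hF.dirDeriv hU f).differentiableAt_of_isOpen hU hp
  have h := dirDeriv_comm (hF.dirDeriv hU e) hU hp f e
  rw [dirDeriv_congr hU hee hp f, dirDeriv_congr hU hfe hp e,
    dirDeriv_const_mul (dA.fun_mul de), dirDeriv_mul dA de, dirDeriv_add (dB.fun_mul de) (dA.fun_mul df),
    dirDeriv_mul dB de, dirDeriv_mul dA df, hee p hp, dirDeriv_comm hF hU hp e f, hfe p hp] at h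
  linear_combination h

/-- The logarithmic derivatives of the Jacobian satisfy the equations characterising the
logarithmic derivatives of the reciprocal of an affine function. -/
theorem dirDeriv_jacobianLogDeriv (hU : IsOpen U) (hu : ContDiffOn ℝ (⊤ : ℕ∞) u U)
    (hv : ContDiffOn ℝ (⊤ : ℕ∞) v U) (hJ : ∀ q ∈ U, jacobian u v q ≠ 0)
    (Hu : IsProjectiveHessian U (jacobianLogDeriv u v) u)
    (Hv : IsProjectiveHessian U (jacobianLogDeriv u v) v) (hp : p ∈ U) :
    dirDeriv (1, 0) (jacobianLogDeriv u v (1, 0)) p = jacobianLogDeriv u v (1, 0) p ^ 2 ∧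
    dirDeriv (0, 1) (jacobianLogDeriv u v (1, 0)) p
      = jacobianLogDeriv u v (1, 0) p * jacobianLogDeriv u v (0, 1) p ∧
    dirDeriv (0, 1) (jacobianLogDeriv u v (0, 1)) p = jacobianLogDeriv u v (0, 1) p ^ 2 := by
  have hA := ContDiffOn.jacobianLogDeriv hU hu hv hJ (1, 0)
  have hB := ContDiffOn.jacobianLogDeriv hU hu hv hJ (0, 1)
  have swap : ∀ F : ℝ × ℝ → ℝ, ContDiffOn ℝ (⊤ : ℕ∞) F U →
      IsProjectiveHessian U (jacobianLogDeriv u v) F → ∀ q ∈ U,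
      dirDeriv (1, 0) (dirDeriv (0, 1) F) q
        = jacobianLogDeriv u v (1, 0) q * dirDeriv (0, 1) F q
          + jacobianLogDeriv u v (0, 1) q * dirDeriv (1, 0) F q := fun F hF H q hq => by
    rw [dirDeriv_comm hF hU hq, H.yx q hq, add_comm]
  obtain ⟨h1, h2⟩ := eq_zero_of_jacobian_ne_zero (hJ p hp)
    (integrability_of_hessian hU hA hB hu Hu.xx Hu.yx hp)
    (integrability_of_hessian hU hA hB hv Hv.xx Hv.yx hp)
  obtain ⟨h3, h4⟩ := eq_zero_of_jacobian_ne_zero (hJ p hp)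
    ((add_comm _ _).trans (integrability_of_hessian hU hB hA hu Hu.yy (swap u hu Hu) hp))
    ((add_comm _ _).trans (integrability_of_hessian hU hB hA hv Hv.yy (swap v hv Hv) hp))
  refine ⟨by linarith, by linarith, by linarith⟩

/-- Multiplying by the weight turns solutions of the projective Hessian equations into affine
functions. -/
theorem dirDeriv_dirDeriv_weight_mul (hU : IsOpen U) {R A B F : ℝ × ℝ → ℝ} {e f : ℝ × ℝ}
    (hR : ContDiffOn ℝ (⊤ : ℕ∞) R U) (hA : ContDiffOn ℝ (⊤ : ℕ∞) A U)
    (hF : ContDiffOn ℝ (⊤ : ℕ∞) F U)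
    (hRe : ∀ q ∈ U, dirDeriv e R q = -(A q * R q)) (hRf : ∀ q ∈ U, dirDeriv f R q = -(B q * R q))
    (hAf : ∀ q ∈ U, dirDeriv f A q = A q * B q)
    (hfe : ∀ q ∈ U, dirDeriv f (dirDeriv e F) q = B q * dirDeriv e F q + A q * dirDeriv f F q)
    (hp : p ∈ U) : dirDeriv f (dirDeriv e (fun q => R q * F q)) p = 0 := by
  have h1 : ∀ q ∈ U, dirDeriv e (fun q => R q * F q) q = R q * (dirDeriv e F q - A q * F q) := by
    intro q hq
    rw [dirDeriv_mul (hR.differentiableAt_of_isOpen hU hq) (hF.differentiableAt_of_isOpen hU hq),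
      hRe q hq]
    ring
  have dR := hR.differentiableAt_of_isOpen hU hp
  have dA := hA.differentiableAt_of_isOpen hU hp
  have dF := hF.differentiableAt_of_isOpen hU hp
  have de := (hF.dirDeriv hU e).differentiableAt_of_isOpen hU hp
  rw [dirDeriv_congr hU h1 hp, dirDeriv_mul dR (de.fun_sub (dA.fun_mul dF)), dirDeriv_sub de (dA.fun_mul dF),
    dirDeriv_mul dA dF, hfe p hp, hRf p hp, hAf p hp]
  ring

theorem isProjectiveHessian_const (U : Set (ℝ × ℝ)) (a : ℝ × ℝ → ℝ × ℝ → ℝ) (c : ℝ) :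
    IsProjectiveHessian U a (fun _ => c) := by
  constructor <;> simp

/-- `R * F` in terms of the first-order jet of `F` at a point `p`, for `R` the weight. -/
theorem weight_mul_eq_affine (hU : IsOpen U) (hUc : IsPreconnected U)
    (hu : ContDiffOn ℝ (⊤ : ℕ∞) u U)
    (hv : ContDiffOn ℝ (⊤ : ℕ∞) v U) (hJ : ∀ q ∈ U, jacobian u v q ≠ 0)
    (Hu : IsProjectiveHessian U (jacobianLogDeriv u v) u)
    (Hv : IsProjectiveHessian U (jacobianLogDeriv u v) v) {F : ℝ × ℝ → ℝ}
    (hF : ContDiffOn ℝ (⊤ : ℕ∞) F U) (HF : IsProjectiveHessian U (jacobianLogDeriv u v) F)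
    (hp : p ∈ U) :
    ∃ k : ℝ, (∀ q ∈ U, jacobianWeight u v q * F q =
      jacobianWeight u v p * (dirDeriv (1, 0) F p - jacobianLogDeriv u v (1, 0) p * F p) * q.1 +
      jacobianWeight u v p * (dirDeriv (0, 1) F p - jacobianLogDeriv u v (0, 1) p * F p) * q.2
        + k) := by
  have hR := ContDiffOn.jacobianWeight hU hu hv hJ
  have hA := ContDiffOn.jacobianLogDeriv hU hu hv hJ (1, 0)
  have hB := ContDiffOn.jacobianLogDeriv hU hu hv hJ (0, 1)
  have hRw : ∀ w, ∀ q ∈ U, dirDeriv w (jacobianWeight u v) q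
      = -(jacobianLogDeriv u v w q * jacobianWeight u v q) := fun w q hq =>
    dirDeriv_jacobianWeight
      ((ContDiffOn.jacobian hU hu hv).differentiableAt_of_isOpen hU hq) (hJ q hq) w
  have hD := fun q hq => dirDeriv_jacobianLogDeriv (p := q) hU hu hv hJ Hu Hv hq
  have h1 : ∀ w, dirDeriv w (fun q => jacobianWeight u v q * F q) p
      = jacobianWeight u v p * (dirDeriv w F p - jacobianLogDeriv u v w p * F p) := fun w => by
    rw [dirDeriv_mul (hR.differentiableAt_of_isOpen hU hp) (hF.differentiableAt_of_isOpen hU hp),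
      hRw w p hp]
    ring
  rw [← h1, ← h1]
  refine ⟨_, fun q hq => eq_affine_of_second_partials_eq_zero
    (F := fun q => jacobianWeight u v q * F q) hU hUc
    (hR.mul hF) (fun r hr => ?_) (fun r hr => ?_) (fun r hr => ?_) hp hq⟩
  · exact dirDeriv_dirDeriv_weight_mul hU hR hA hF (hRw _) (hRw _)
      (fun r hr => (hD r hr).1.trans (sq _)) (fun r hr => (HF.xx r hr).trans (two_mul _)) hr
  · exact dirDeriv_dirDeriv_weight_mul hU hR hA hF (hRw _) (hRw _)
      (fun r hr => (hD r hr).2.1) HF.yx hr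
  · exact dirDeriv_dirDeriv_weight_mul hU hR hB hF (hRw _) (hRw _)
      (fun r hr => (hD r hr).2.2.trans (sq _)) (fun r hr => (HF.yy r hr).trans (two_mul _)) hr

end Jacobian

section Uniqueness

/-- A `3 × 3` matrix for which all points of a nonempty open subset of the affine plane are
eigenvectors is scalar. -/
theorem exists_eq_smul_one_of_eigenvectors {U : Set (ℝ × ℝ)} (hU : IsOpen U) (hne : U.Nonempty)
    (M : Matrix (Fin 3) (Fin 3) ℝ)
    (h : ∀ p ∈ U, ∃ c : ℝ, M.mulVec ![p.1, p.2, 1] = c • ![p.1, p.2, 1]) :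
    ∃ c : ℝ, M = c • (1 : Matrix (Fin 3) (Fin 3) ℝ) := by
  obtain ⟨⟨a, b⟩, hp⟩ := hne
  obtain ⟨δ, hδ, hball⟩ := Metric.isOpen_iff.mp hU _ hp
  set t := δ / 2 with ht
  have htpos : 0 < t := by positivity
  have hin : ∀ x y : ℝ, |x| ≤ t → |y| ≤ t → (a + x, b + y) ∈ U := by
    intro x y hx hy
    apply hball
    rw [Metric.mem_ball, Prod.dist_eq, Real.dist_eq, Real.dist_eq, max_lt_iff]
    constructor <;> simp only [add_sub_cancel_left] <;> linarith
  have h0 : |(0 : ℝ)| ≤ t := by simpa using htpos.le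
  have h1 : |t| ≤ t := (abs_of_pos htpos).le
  obtain ⟨c1, e1⟩ := h _ (hin 0 0 h0 h0)
  obtain ⟨c2, e2⟩ := h _ (hin t 0 h1 h0)
  obtain ⟨c3, e3⟩ := h _ (hin 0 t h0 h1)
  obtain ⟨c4, e4⟩ := h _ (hin t t h1 h1)
  have expand : ∀ x y c : ℝ, M.mulVec ![x, y, 1] = c • ![x, y, 1] →
      ∀ i, M i 0 * x + M i 1 * y + M i 2 = c * (![x, y, 1] : Fin 3 → ℝ) i := by
    intro x y c hh i
    have := congrFun hh i
    simpa [Matrix.mulVec, dotProduct, Fin.sum_univ_three] using this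
  have hc : c2 = c1 ∧ c3 = c1 := by
    have r0 := expand _ _ _ e1
    have r1 := expand _ _ _ e2
    have r2 := expand _ _ _ e3
    have r3 := expand _ _ _ e4
    have k2 : c4 = c2 + c3 - c1 := by
      have := r0 2; have := r1 2; have := r2 2; have := r3 2
      simp at *
      linarith
    constructor
    · apply mul_left_cancel₀ htpos.ne'
      have q0 := r0 1; have q1 := r1 1; have q2 := r2 1; have q3 := r3 1
      simp at q0 q1 q2 q3
      subst k2
      linear_combination q1 + q2 - q0 - q3
    · apply mul_left_cancel₀ htpos.ne'
      have q0 := r0 0; have q1 := r1 0; have q2 := r2 0; have q3 := r3 0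
      simp at q0 q1 q2 q3
      subst k2
      linear_combination q1 + q2 - q0 - q3
  obtain ⟨rfl, rfl⟩ := hc
  refine ⟨c3, ?_⟩
  have col : ∀ i, M i 0 = c3 * (![1, 0, 0] : Fin 3 → ℝ) i ∧
      M i 1 = c3 * (![0, 1, 0] : Fin 3 → ℝ) i ∧ M i 2 = c3 * (![0, 0, 1] : Fin 3 → ℝ) i := by
    intro i
    have q0 := expand _ _ _ e1 i
    have q1 := expand _ _ _ e2 i
    have q2 := expand _ _ _ e3 i
    have m0 : M i 0 = c3 * (![1, 0, 0] : Fin 3 → ℝ) i := by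
      apply mul_left_cancel₀ htpos.ne'
      fin_cases i <;> simp [-mul_eq_mul_left_iff, -mul_eq_zero] at q0 q1 ⊢ <;> linarith
    have m1 : M i 1 = c3 * (![0, 1, 0] : Fin 3 → ℝ) i := by
      apply mul_left_cancel₀ htpos.ne'
      fin_cases i <;> simp [-mul_eq_mul_left_iff, -mul_eq_zero] at q0 q2 ⊢ <;> linarith
    refine ⟨m0, m1, ?_⟩
    rw [m0, m1] at q0
    fin_cases i <;> simp at q0 ⊢ <;> linarith
  ext i j
  fin_cases j
  · exact (col i).1.trans (by fin_cases i <;> simp)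
  · exact (col i).2.1.trans (by fin_cases i <;> simp)
  · exact (col i).2.2.trans (by fin_cases i <;> simp)

theorem AgreesOn.eq_smul {U : Set (ℝ × ℝ)} (hU : IsOpen U) (hne : U.Nonempty)
    {ψ : ℝ × ℝ → ℝ × ℝ} {g g' : Matrix (Fin 3) (Fin 3) ℝ} (hg : IsUnit g) (hg' : IsUnit g')
    (h : AgreesOn g ψ U) (h' : AgreesOn g' ψ U) : ∃ c : ℝ, c ≠ 0 ∧ g' = c • g := by
  have hdet := (Matrix.isUnit_iff_isUnit_det g).mp hg
  have hprop : ∀ p ∈ U, ∃ c : ℝ, g'.mulVec ![p.1, p.2, 1] = c • g.mulVec ![p.1, p.2, 1] := by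
    intro p hp
    obtain ⟨n, e⟩ := h p hp
    obtain ⟨n', e'⟩ := h' p hp
    rw [e', Prod.mk.injEq, div_eq_div_iff n' n, div_eq_div_iff n' n] at e
    refine ⟨g'.mulVec ![p.1, p.2, 1] 2 / g.mulVec ![p.1, p.2, 1] 2, ?_⟩
    ext i
    rw [Pi.smul_apply, smul_eq_mul, div_mul_eq_mul_div, eq_div_iff n]
    fin_cases i
    · exact e.1.trans (mul_comm _ _)
    · exact e.2.trans (mul_comm _ _)
    · rfl
  obtain ⟨c, hc⟩ := exists_eq_smul_one_of_eigenvectors hU hne (g⁻¹ * g') fun p hp => by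
    obtain ⟨c, hc⟩ := hprop p hp
    refine ⟨c, ?_⟩
    rw [← Matrix.mulVec_mulVec, hc, Matrix.mulVec_smul, Matrix.mulVec_mulVec,
      Matrix.nonsing_inv_mul _ hdet, Matrix.one_mulVec]
  have hgc : g' = c • g := by
    rw [← Matrix.mul_nonsing_inv_cancel_left g g' hdet, hc]
    simp
  refine ⟨c, ?_, hgc⟩
  rintro rfl
  rw [zero_smul] at hgc
  exact hg'.ne_zero hgc

end Uniqueness

section Existence

/-- A local diffeomorphism whose components solve the projective Hessian equations is the
restriction of a projective transformation. -/
theorem exists_agreesOn_of_isProjectiveHessian {U : Set (ℝ × ℝ)} (hU : IsOpen U)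
    (hUc : IsConnected U) {ψ : ℝ × ℝ → ℝ × ℝ}
    (hu : ContDiffOn ℝ (⊤ : ℕ∞) (fun p => (ψ p).1) U)
    (hv : ContDiffOn ℝ (⊤ : ℕ∞) (fun p => (ψ p).2) U)
    (hJ : ∀ q ∈ U, jacobian (fun p => (ψ p).1) (fun p => (ψ p).2) q ≠ 0)
    (Hu : IsProjectiveHessian U (jacobianLogDeriv (fun p => (ψ p).1) (fun p => (ψ p).2))
      (fun p => (ψ p).1))
    (Hv : IsProjectiveHessian U (jacobianLogDeriv (fun p => (ψ p).1) (fun p => (ψ p).2))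
      (fun p => (ψ p).2)) :
    ∃ g : Matrix (Fin 3) (Fin 3) ℝ, IsUnit g ∧ AgreesOn g ψ U := by
  obtain ⟨p, hp⟩ := hUc.nonempty
  have hUp := hUc.isPreconnected
  obtain ⟨k1, h1⟩ := weight_mul_eq_affine hU hUp hu hv hJ Hu Hv hu Hu hp
  obtain ⟨k2, h2⟩ := weight_mul_eq_affine hU hUp hu hv hJ Hu Hv hv Hv hp
  obtain ⟨k3, h3⟩ := weight_mul_eq_affine hU hUp hu hv hJ Hu Hv
    (contDiffOn_const (c := (1 : ℝ))) (isProjectiveHessian_const U _ 1) hp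
  have hRpos : ∀ q, 0 < jacobianWeight (fun p => (ψ p).1) (fun p => (ψ p).2) q :=
    fun q => Real.exp_pos _
  have h1p := h1 p hp
  have h2p := h2 p hp
  have h3p := h3 p hp
  have hJp := hJ p hp
  have hRp := (hRpos p).ne'
  simp only [dirDeriv_const, zero_sub, mul_one] at h3 h3p
  generalize jacobianWeight (fun p => (ψ p).1) (fun p => (ψ p).2) = R at *
  unfold jacobian at hJp
  generalize jacobianLogDeriv (fun p => (ψ p).1) (fun p => (ψ p).2) (1, 0) p = A at *
  generalize jacobianLogDeriv (fun p => (ψ p).1) (fun p => (ψ p).2) (0, 1) p = B at *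
  generalize dirDeriv (1, 0) (fun p => (ψ p).1) p = ux at *
  generalize dirDeriv (0, 1) (fun p => (ψ p).1) p = uy at *
  generalize dirDeriv (1, 0) (fun p => (ψ p).2) p = vx at *
  generalize dirDeriv (0, 1) (fun p => (ψ p).2) p = vy at *
  refine ⟨!![R p * (ux - A * (ψ p).1), R p * (uy - B * (ψ p).1), k1;
    R p * (vx - A * (ψ p).2), R p * (vy - B * (ψ p).2), k2;
    R p * (-A), R p * (-B), k3], ?_, fun q hq => ?_⟩
  · rw [Matrix.isUnit_iff_isUnit_det, isUnit_iff_ne_zero, Matrix.det_fin_three]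
    obtain rfl := eq_sub_of_add_eq' h1p.symm
    obtain rfl := eq_sub_of_add_eq' h2p.symm
    obtain rfl := eq_sub_of_add_eq' h3p.symm
    simp only [Matrix.of_apply, Matrix.cons_val', Matrix.cons_val_zero, Matrix.cons_val_one,
      Matrix.cons_val]
    convert mul_ne_zero (pow_ne_zero 3 hRp) hJp using 1
    ring
  · have hq1 := h1 q hq
    have hq2 := h2 q hq
    have hq3 := h3 q hq
    have hRq := (hRpos q).ne'
    simp only [Matrix.mulVec, dotProduct, Fin.sum_univ_three, Matrix.of_apply, Matrix.cons_val',
      Matrix.cons_val_zero, Matrix.cons_val_one, Matrix.cons_val, mul_one]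
    rw [← hq1, ← hq2, ← hq3]
    exact ⟨hRq, Prod.ext (by field_simp) (by field_simp)⟩

end Existence

/-- The Jacobian of a map with a differentiable left inverse does not vanish. -/
theorem jacobian_ne_zero_of_leftInverse {U : Set (ℝ × ℝ)} (hU : IsOpen U)
    {ψ ψinv : ℝ × ℝ → ℝ × ℝ} {p : ℝ × ℝ} (hp : p ∈ U) (hψ : DifferentiableAt ℝ ψ p)
    (hψinv : DifferentiableAt ℝ ψinv (ψ p)) (hinv : ∀ q ∈ U, ψinv (ψ q) = q) :
    jacobian (fun q => (ψ q).1) (fun q => (ψ q).2) p ≠ 0 := by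
  apply jacobian_ne_zero_of_injective
  intro w h1 h2
  have hw : fderiv ℝ ψ p w = 0 := by
    refine Prod.ext ?_ ?_
    · rwa [dirDeriv, hψ.hasFDerivAt.fst.fderiv] at h1
    · rwa [dirDeriv, hψ.hasFDerivAt.snd.fderiv] at h2
  have hcomp : HasFDerivAt (ψinv ∘ ψ) (ContinuousLinearMap.id ℝ (ℝ × ℝ)) p :=
    (hasFDerivAt_id p).congr_of_eventuallyEq
      (Filter.eventuallyEq_of_mem (hU.mem_nhds hp) hinv)
  have := congrArg (fun L => L w)
    (hcomp.unique (hψinv.hasFDerivAt.comp p hψ.hasFDerivAt))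
  simpa [hw] using this

/-- A diffeomorphism `ψ : U → V` between connected open subsets of `ℝ²` mapping every line
segment contained in `U` into a line segment extends uniquely (up to scalar, i.e. uniquely in
`PGL(3,ℝ)`) to a projective linear transformation agreeing with `ψ` on `U`. -/
theorem stmt11 (U V : Set (ℝ × ℝ)) (hU : IsOpen U) (hV : IsOpen V)
    (hUc : IsConnected U) (hVc : IsConnected V)
    (ψ ψinv : ℝ × ℝ → ℝ × ℝ)
    (hbij : Set.BijOn ψ U V)
    (hsm : ContDiffOn ℝ (⊤ : ℕ∞) ψ U) (hsminv : ContDiffOn ℝ (⊤ : ℕ∞) ψinv V)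
    (hinv : ∀ p ∈ U, ψinv (ψ p) = p)
    (hseg : ∀ p q : ℝ × ℝ, segment ℝ p q ⊆ U →
      ∃ p' q' : ℝ × ℝ, ψ '' segment ℝ p q ⊆ segment ℝ p' q') :
    ∃ g : Matrix (Fin 3) (Fin 3) ℝ, IsUnit g ∧ AgreesOn g ψ U ∧
      ∀ g' : Matrix (Fin 3) (Fin 3) ℝ, IsUnit g' → AgreesOn g' ψ U →
        ∃ c : ℝ, c ≠ 0 ∧ g' = c • g := by
  have hu : ContDiffOn ℝ (⊤ : ℕ∞) (fun p => (ψ p).1) U := hsm.fst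
  have hv : ContDiffOn ℝ (⊤ : ℕ∞) (fun p => (ψ p).2) U := hsm.snd
  have hJ : ∀ q ∈ U, jacobian (fun p => (ψ p).1) (fun p => (ψ p).2) q ≠ 0 := fun q hq =>
    jacobian_ne_zero_of_leftInverse hU hq
      ((hsm.contDiffAt (hU.mem_nhds hq)).differentiableAt (by simp))
      ((hsminv.contDiffAt (hV.mem_nhds (hbij.mapsTo hq))).differentiableAt (by simp)) hinv
  obtain ⟨Hu, Hv⟩ := isProjectiveHessian_of_parallel hU hu hv hJ
    fun q hq w => acceleration_parallel_velocity hU hu hv hseg hq w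
  obtain ⟨g, hg, hag⟩ := exists_agreesOn_of_isProjectiveHessian hU hUc hu hv hJ Hu Hv
  exact ⟨g, hg, hag, fun g' hg' hag' => hag.eq_smul hU hUc.nonempty hg hg' hag'⟩
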